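/- The symmetric group S_n admits a faithful orthogonal representation on ℝ^{n-1} (the standard representation on the hyperplane of vectors with coordinate sum zero), and every faithful real linear representation of S_n for n ≥ 3 has dimension at least n - 1. -/

import Mathlib

open Equiv Module

/-- The line condition on `(-1)`-eigenspaces is invariant under conjugation. -/
theorem exists_smul_of_swap_eigen {α V : Type*} [DecidableEq α] [AddCommGroup V] [Module ℝ V]
    (ρ : Perm α →* End ℝ V) {o e : α} (hoe : o ≠ e)
    (hline : finrank ℝ (LinearMap.ker (ρ (swap o e) + 1)) = 1) {a b : α} (hab : a ≠ b)
    {x y : V} (hx : ρ (swap a b) x = -x) (hy : ρ (swap a b) y = -y) (hx0 : x ≠ 0) :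
    ∃ r : ℝ, y = r • x := by
  obtain ⟨c, hc⟩ := isConj_iff.1 (Perm.isConj_swap hoe hab)
  have key : ∀ z : V, ρ (swap a b) z = -z → ρ c⁻¹ z ∈ LinearMap.ker (ρ (swap o e) + 1) := by
    intro z hz
    have h1 : swap o e * c⁻¹ = c⁻¹ * swap a b := by rw [← hc]; group
    have h2 : ρ (swap o e) (ρ c⁻¹ z) = ρ c⁻¹ (ρ (swap a b) z) := by
      rw [← End.mul_apply, ← map_mul, h1, map_mul, End.mul_apply]
    simp [LinearMap.mem_ker, h2, hz]
  have hinv : ∀ z : V, ρ c (ρ c⁻¹ z) = z := by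
    intro z
    rw [← End.mul_apply, ← map_mul]
    simp
  have hne : (⟨ρ c⁻¹ x, key x hx⟩ : LinearMap.ker (ρ (swap o e) + 1)) ≠ 0 := by
    intro h
    apply hx0
    have h3 : ρ c⁻¹ x = 0 := congrArg Subtype.val h
    rw [← hinv x, h3, map_zero]
  obtain ⟨r, hr⟩ := (finrank_eq_one_iff_of_nonzero' _ hne).1 hline ⟨_, key y hy⟩
  refine ⟨r, ?_⟩
  have h4 : r • ρ c⁻¹ x = ρ c⁻¹ y := congrArg Subtype.val hr
  rw [← hinv y, ← h4, map_smul, hinv]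

theorem rho_swap_swap {α V : Type*} [DecidableEq α] [AddCommGroup V] [Module ℝ V]
    (ρ : Perm α →* End ℝ V) (a b : α) (x : V) : ρ (swap a b) (ρ (swap a b) x) = x := by
  rw [← End.mul_apply, ← map_mul]
  simp

theorem rho_swap_braid {α V : Type*} [DecidableEq α] [AddCommGroup V] [Module ℝ V]
    (ρ : Perm α →* End ℝ V) {a b c : α} (hac : a ≠ c) (hbc : b ≠ c) (x : V) :
    ρ (swap a b) (ρ (swap a c) (ρ (swap a b) x)) = ρ (swap b c) x := by
  rw [← End.mul_apply, ← End.mul_apply, ← map_mul, ← map_mul, swap_comm a c,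
    swap_mul_swap_mul_swap hac.symm hbc.symm]

theorem rho_swap_comm {α V : Type*} [DecidableEq α] [AddCommGroup V] [Module ℝ V]
    (ρ : Perm α →* End ℝ V) {a b c d : α} (hac : a ≠ c) (had : a ≠ d) (hbc : b ≠ c)
    (hbd : b ≠ d) (x : V) :
    ρ (swap a b) (ρ (swap c d) x) = ρ (swap c d) (ρ (swap a b) x) := by
  rw [← End.mul_apply, ← End.mul_apply, ← map_mul, ← map_mul, swap_mul_eq_mul_swap]
  simp [swap_apply_of_ne_of_ne, *]

/-- If transpositions act by reflections and distinct transpositions act differently, a root is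
fixed by every disjoint transposition. -/
theorem rho_swap_root_of_disjoint {α V : Type*} [Fintype α] [DecidableEq α] [AddCommGroup V]
    [Module ℝ V] (ρ : Perm α →* End ℝ V) (hcard : 5 ≤ Fintype.card α)
    (hρ : ∀ a b c, a ≠ b → a ≠ c → b ≠ c → ρ (swap a b) ≠ ρ (swap a c)) {o e : α} (hoe : o ≠ e)
    (hline : finrank ℝ (LinearMap.ker (ρ (swap o e) + 1)) = 1) {a b c d : α} (hab : a ≠ b)
    (hac : a ≠ c) (had : a ≠ d) (hbc : b ≠ c) (hbd : b ≠ d) (hcd : c ≠ d) {x : V}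
    (hx : ρ (swap a b) x = -x) : ρ (swap c d) x = x := by
  by_contra hne
  set y := x - ρ (swap c d) x with hy
  have hy0 : y ≠ 0 := fun h => hne (sub_eq_zero.1 h).symm
  have hyab : ρ (swap a b) y = -y := by
    rw [hy, map_sub, rho_swap_comm ρ hac had hbc hbd, hx, map_neg]; abel
  have hycd : ρ (swap c d) y = -y := by
    rw [hy, map_sub, rho_swap_swap]; abel
  obtain ⟨f, -, hf⟩ : ∃ f ∈ Finset.univ, f ∉ ({a, b, c, d} : Finset α) :=
    Finset.exists_mem_notMem_of_card_lt_card
      (Finset.card_le_four.trans_lt (by rw [Finset.card_univ]; omega))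
  simp only [Finset.mem_insert, Finset.mem_singleton, not_or] at hf
  obtain ⟨hfa, hfb, hfc, hfd⟩ := hf
  have hyaf : ρ (swap a f) y = -y := by
    set y' := ρ (swap b f) y with hy'
    have h1 : ρ (swap c d) y' = -y' := by
      rw [hy', rho_swap_comm ρ hbc.symm (Ne.symm hfc) hbd.symm (Ne.symm hfd), hycd, map_neg]
    have h2 : ρ (swap a f) y' = -y' := by
      have h3 := rho_swap_braid ρ hab.symm hfa y'
      rw [hy', rho_swap_swap, swap_comm b a, hyab, map_neg, swap_comm f a] at h3
      exact h3.symm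
    have hy'0 : y' ≠ 0 := by
      intro h
      apply hy0
      rw [← rho_swap_swap ρ b f y, ← hy', h, map_zero]
    obtain ⟨r, hr⟩ := exists_smul_of_swap_eigen ρ hoe hline hcd h1 hycd hy'0
    rw [hr, map_smul, h2, smul_neg]
  apply hρ a b f hab (Ne.symm hfa) (Ne.symm hfb)
  ext z
  obtain ⟨φ, hφ⟩ := exists_smul_of_swap_eigen ρ hoe hline hab hyab
    (y := z - ρ (swap a b) z) (by rw [map_sub, rho_swap_swap]; abel) hy0
  obtain ⟨ψ, hψ⟩ := exists_smul_of_swap_eigen ρ hoe hline (Ne.symm hfa) hyaf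
    (y := z - ρ (swap a f) z) (by rw [map_sub, rho_swap_swap]; abel) hy0
  have hφ' : ρ (swap a b) z = z - φ • y := by rw [← hφ]; abel
  have hψ' : ρ (swap a f) z = z - ψ • y := by rw [← hψ]; abel
  have h1 := rho_swap_braid ρ (Ne.symm hfa) (Ne.symm hfb) z
  have h2 := rho_swap_braid ρ hab hfb z
  rw [swap_comm f b, ← h1] at h2
  simp only [hφ', hψ', map_sub, map_smul, map_neg, hyab, hyaf, neg_neg] at h2
  have h3 : (3 * (φ - ψ)) • y = 0 := by
    rw [← sub_eq_zero] at h2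
    rw [← h2]
    module
  have h4 : φ = ψ := by
    rcases smul_eq_zero.1 h3 with h | h
    · linarith
    · exact absurd h hy0
  rw [hφ', hψ', h4]

/-- If transpositions act by reflections and distinct transpositions act differently, the
dimension is at least `card α - 1`. -/
theorem card_sub_one_le_finrank_of_reflection {α V : Type*} [Fintype α] [DecidableEq α]
    [AddCommGroup V] [Module ℝ V] [FiniteDimensional ℝ V] (ρ : Perm α →* End ℝ V)
    (hcard : 5 ≤ Fintype.card α)
    (hρ : ∀ a b c, a ≠ b → a ≠ c → b ≠ c → ρ (swap a b) ≠ ρ (swap a c)) {o e : α} (hoe : o ≠ e)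
    (hline : finrank ℝ (LinearMap.ker (ρ (swap o e) + 1)) = 1) :
    Fintype.card α - 1 ≤ finrank ℝ V := by
  obtain ⟨⟨v, hv⟩, hv0, -⟩ := finrank_eq_one_iff'.1 hline
  replace hv0 : v ≠ 0 := fun h => hv0 (Subtype.ext h)
  replace hv : ρ (swap o e) v = -v := by
    simpa [LinearMap.mem_ker, add_eq_zero_iff_eq_neg] using hv
  have hfix := @rho_swap_root_of_disjoint α V _ _ _ _ ρ hcard hρ o e hoe hline
  let w : α → V := fun j => ρ (swap e j) v
  have hwe : w e = v := by
    change ρ (swap e e) v = v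
    rw [show swap e e = 1 from swap_self e, map_one, End.one_apply]
  have hw0 : ∀ j, w j ≠ 0 := by
    intro j h
    apply hv0
    rw [← rho_swap_swap ρ e j v]
    change ρ (swap e j) (w j) = 0
    rw [h, map_zero]
  have hroot : ∀ j, j ≠ o → ρ (swap o j) (w j) = -w j := by
    intro j hj
    rcases eq_or_ne j e with rfl | hje
    · rwa [hwe]
    · have h := rho_swap_braid ρ hoe.symm hj (w j)
      rw [show ρ (swap e j) (w j) = v from rho_swap_swap ρ e j v, swap_comm e o, hv, map_neg,
        swap_comm j o] at h
      exact h.symm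
  have hswap : ∀ i k, i ≠ o → k ≠ o → i ≠ k → ρ (swap i k) (w i) = w k := by
    intro i k hi hk hik
    rcases eq_or_ne i e with rfl | hie
    · rw [hwe]
    rcases eq_or_ne k e with rfl | hke
    · rw [hwe, swap_comm]
      exact rho_swap_swap ρ k i v
    have h := rho_swap_braid ρ hie hke v
    rw [hfix hoe hi.symm hk.symm hie.symm hke.symm hik hv] at h
    simpa only [w, swap_comm e] using h
  have hrest : ∀ i k j, i ≠ o → k ≠ o → j ≠ o → i ≠ k → i ≠ j → k ≠ j →
      ρ (swap i k) (w j) = w j := fun i k j hi hk hj hik hij hkj =>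
    hfix hj.symm hi.symm hk.symm hij.symm hkj.symm hik (hroot j hj)
  have hrefl : ∀ i j, i ≠ o → j ≠ o → i ≠ j → ρ (swap o i) (w j) = w j - w i := by
    intro i j hi hj hij
    obtain ⟨b, hb⟩ := exists_smul_of_swap_eigen ρ hoe hline hi.symm (hroot i hi)
      (y := w j - ρ (swap o i) (w j)) (by rw [map_sub, rho_swap_swap]; abel) (hw0 i)
    have hb1 : ρ (swap o i) (w j) = w j - b • w i := by rw [← hb]; abel
    have hji : ρ (swap i j) (w j) = w i := by rw [swap_comm]; exact hswap j i hj hi hij.symm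
    have hij' := hswap i j hi hj hij
    have hb2 : ρ (swap o j) (w i) = w i - b • w j := by
      have h := rho_swap_braid ρ hi hj (w i)
      rw [hij', swap_comm i o, hb1, map_sub, map_smul, hji, hij', swap_comm j o] at h
      exact h.symm
    have h1 := rho_swap_braid ρ hj.symm hij (w i)
    rw [hroot i hi, map_neg, hb2, map_neg, map_sub, map_smul, hroot i hi, hb1, hij'] at h1
    by_cases hb' : b = 1
    · rw [hb1, hb', one_smul]
    exfalso
    have h2 : (1 + b) • w i = w j := by
      have h3 : (1 - b) • ((1 + b) • w i - w j) = 0 := by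
        rw [← sub_eq_zero] at h1
        rw [← h1]
        module
      rcases smul_eq_zero.1 h3 with h | h
      · exact absurd (by linarith) hb'
      · exact sub_eq_zero.1 h
    obtain ⟨k, -, hk⟩ : ∃ k ∈ Finset.univ, k ∉ ({o, i, j} : Finset α) :=
      Finset.exists_mem_notMem_of_card_lt_card
        (Finset.card_le_three.trans_lt (by rw [Finset.card_univ]; omega))
    simp only [Finset.mem_insert, Finset.mem_singleton, not_or] at hk
    obtain ⟨hko, hki, hkj⟩ := hk
    have hjk : w j = w k := by
      have h := congrArg (ρ (swap j k)) h2
      rwa [map_smul, hrest j k i hj hko hi (Ne.symm hkj) hij.symm hki, h2,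
        hswap j k hj hko (Ne.symm hkj)] at h
    have hik : w i = w j := by
      have h := congrArg (ρ (swap i j)) hjk
      rwa [hji, hrest i j k hi hj hko hij (Ne.symm hki) (Ne.symm hkj), ← hjk] at h
    rw [← hik] at h2
    rw [← hik, hroot i hi] at hb1
    have h5 : b • w i = 0 := by
      rw [← sub_eq_zero] at h2
      rw [← h2]; module
    have h6 : (2 - b) • w i = 0 := by
      rw [← sub_eq_zero] at hb1
      rw [← neg_eq_zero, ← hb1]; module
    have h7 := (smul_eq_zero.1 h5).resolve_right (hw0 i)
    have h8 := (smul_eq_zero.1 h6).resolve_right (hw0 i)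
    linarith
  have hind : LinearIndependent ℝ (fun j : {j // j ≠ o} => w j) := by
    rw [Fintype.linearIndependent_iff]
    intro c hc
    have hci : ∀ i, c i = -∑ j, c j := by
      intro i
      have h := congrArg (ρ (swap o i)) hc
      rw [map_sum, map_zero] at h
      have h1 : ∀ j : {j // j ≠ o}, ρ (swap o i) (c j • w j) =
          c j • w j - (c j + if j = i then c j else 0) • w i := by
        intro j
        rw [map_smul]
        split_ifs with hji
        · rw [hji, hroot i i.2]; module
        · rw [hrefl i j i.2 j.2 (fun h => hji (Subtype.ext h.symm))]; module
      rw [Finset.sum_congr rfl fun j _ => h1 j, Finset.sum_sub_distrib, hc, ← Finset.sum_smul,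
        zero_sub, neg_eq_zero, Finset.sum_add_distrib] at h
      have h2 := (smul_eq_zero.1 h).resolve_right (hw0 i)
      simp at h2
      linarith
    have hsum : ∑ j, c j = 0 := by
      have h : ∑ j, c j = ∑ _j : {j // j ≠ o}, -∑ j, c j := Finset.sum_congr rfl fun i _ => hci i
      rw [Finset.sum_const, nsmul_eq_mul] at h
      have h3 : (1 + ((Finset.univ : Finset {j // j ≠ o}).card : ℝ)) * ∑ j, c j = 0 := by linarith
      exact (mul_eq_zero.1 h3).resolve_left (by
        have h4 := Nat.cast_nonneg (α := ℝ) (Finset.univ : Finset {j // j ≠ o}).card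
        linarith)
    intro i
    rw [hci i, hsum, neg_zero]
  have h := hind.fintype_card_le_finrank
  rwa [Fintype.card_subtype_compl, Fintype.card_subtype_eq] at h

/-- A representation nontrivial on an even permutation separates transpositions sharing a point. -/
theorem rho_swap_ne_of_even {α M : Type*} [Fintype α] [DecidableEq α] [Monoid M]
    (ρ : Perm α →* M) {z : Perm α} (hz : Perm.sign z = 1) (hρz : ρ z ≠ 1) (a b c : α)
    (hab : a ≠ b) (hac : a ≠ c) (hbc : b ≠ c) : ρ (swap a b) ≠ ρ (swap a c) := by
  intro h
  have h1 : swap a b * swap a c ∈ ρ.ker := by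
    rw [MonoidHom.mem_ker, map_mul, ← h, ← map_mul, swap_mul_self, map_one]
  have h2 : alternatingGroup α ≤ ρ.ker := by
    rw [← Perm.closure_three_cycles_eq_alternating, Subgroup.closure_le]
    intro σ hσ
    have h3 : IsConj (swap a b * swap a c) σ := Perm.isConj_iff_cycleType_eq.2
      ((Perm.isThreeCycle_swap_mul_swap_same hab hac hbc).cycleType.trans hσ.cycleType.symm)
    obtain ⟨g, rfl⟩ := isConj_iff.1 h3
    exact Subgroup.Normal.conj_mem inferInstance _ h1 g
  exact hρz (h2 (Perm.mem_alternatingGroup.2 hz))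

/-- Restriction of a representation to an invariant submodule. -/
def restrictRep {G V : Type*} [Monoid G] [AddCommGroup V] [Module ℝ V] (ρ : G →* End ℝ V)
    (W : Submodule ℝ V) (hW : ∀ g, ∀ x ∈ W, ρ g x ∈ W) : G →* End ℝ W where
  toFun g := (ρ g).restrict (hW g)
  map_one' := by ext; simp
  map_mul' g h := by ext; simp

theorem card_sub_one_le_finrank_of_ne_on_fixed {α V : Type} [Fintype α] [DecidableEq α]
    [AddCommGroup V] [Module ℝ V] [FiniteDimensional ℝ V] (hcard : 5 ≤ Fintype.card α) {a b : α}
    (hab : a ≠ b) {z : Perm {x // x ≠ a ∧ x ≠ b}} (hz : Perm.sign z = 1)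
    (hdim : ∀ (W : Type) [AddCommGroup W] [Module ℝ W] [FiniteDimensional ℝ W]
      (ρ : Perm {x // x ≠ a ∧ x ≠ b} →* End ℝ W), ρ z ≠ 1 → Fintype.card α - 3 ≤ finrank ℝ W)
    (ρ : Perm α →* End ℝ V) {v : V} (hv : ρ (swap a b) v = v)
    (hzv : ρ (Perm.ofSubtype z) v ≠ v) : Fintype.card α - 1 ≤ finrank ℝ V := by
  have hρz : ρ (Perm.ofSubtype z) ≠ 1 := fun h => hzv (by rw [h, End.one_apply])
  have hρ := rho_swap_ne_of_even ρ ((Perm.sign_ofSubtype z).trans hz) hρz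
  have hcomm : ∀ (g : Perm {x // x ≠ a ∧ x ≠ b}) (x : V),
      ρ (swap a b) (ρ (Perm.ofSubtype g) x) = ρ (Perm.ofSubtype g) (ρ (swap a b) x) := by
    intro g x
    have h := mul_swap_eq_swap_mul (Perm.ofSubtype g) a b
    rw [Perm.ofSubtype_apply_of_not_mem g (by simp), Perm.ofSubtype_apply_of_not_mem g (by simp)]
      at h
    rw [← End.mul_apply, ← End.mul_apply, ← map_mul, ← map_mul, h]
  let P := LinearMap.ker (ρ (swap a b) - 1)
  let N := LinearMap.ker (ρ (swap a b) + 1)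
  have hmemP : ∀ x, x ∈ P ↔ ρ (swap a b) x = x := by
    intro x; simp [P, LinearMap.mem_ker, sub_eq_zero]
  have hmemN : ∀ x, x ∈ N ↔ ρ (swap a b) x = -x := by
    intro x; simp [N, LinearMap.mem_ker, add_eq_zero_iff_eq_neg]
  have hP : Fintype.card α - 3 ≤ finrank ℝ P := by
    refine hdim P (restrictRep (ρ.comp Perm.ofSubtype) P fun g x hx => ?_) fun h => hzv ?_
    · rw [hmemP] at hx ⊢
      rw [MonoidHom.comp_apply, hcomm, hx]
    · exact congrArg Subtype.val (LinearMap.congr_fun h ⟨v, (hmemP v).2 hv⟩)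
  have hsum : finrank ℝ P + finrank ℝ N ≤ finrank ℝ V := by
    have h : P ⊓ N = ⊥ := by
      rw [eq_bot_iff]
      intro x hx
      have h1 := (hmemP x).1 hx.1
      rw [(hmemN x).1 hx.2] at h1
      have h2 : (2 : ℝ) • x = 0 := by
        rw [two_smul]
        nth_rewrite 1 [← h1]
        exact neg_add_cancel x
      exact (smul_eq_zero.1 h2).resolve_left two_ne_zero
    rw [← Submodule.finrank_sup_add_finrank_inf_eq, h, finrank_bot, add_zero]
    exact Submodule.finrank_le _
  have hN : finrank ℝ N ≠ 0 := by
    intro h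
    have hN0 := Submodule.finrank_eq_zero.1 h
    have hone : ρ (swap a b) = 1 := by
      ext x
      have hx : x - ρ (swap a b) x ∈ N := by
        rw [hmemN, map_sub, rho_swap_swap]; abel
      rw [hN0, Submodule.mem_bot, sub_eq_zero] at hx
      exact hx.symm
    obtain ⟨c, -, hc⟩ : ∃ c ∈ Finset.univ, c ∉ ({a, b} : Finset α) :=
      Finset.exists_mem_notMem_of_card_lt_card
        (Finset.card_le_two.trans_lt (by rw [Finset.card_univ]; omega))
    simp only [Finset.mem_insert, Finset.mem_singleton, not_or] at hc
    obtain ⟨g, hg⟩ := isConj_iff.1 (Perm.isConj_swap hab (Ne.symm hc.1))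
    apply hρ a b c hab (Ne.symm hc.1) (Ne.symm hc.2)
    rw [← hg, map_mul, map_mul, hone, mul_one, ← map_mul, mul_inv_cancel, map_one]
  by_cases hN1 : finrank ℝ N = 1
  · exact card_sub_one_le_finrank_of_reflection ρ hcard hρ hab hN1
  · omega

/-- The twist of a representation of a symmetric group by the sign character. -/
def signTwist {α V : Type*} [Fintype α] [DecidableEq α] [AddCommGroup V] [Module ℝ V]
    (ρ : Perm α →* End ℝ V) : Perm α →* End ℝ V where
  toFun g := ((Perm.sign g : ℤ) : ℝ) • ρ g
  map_one' := by simp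
  map_mul' g h := by simp [mul_smul_mul_comm]

theorem exists_matrix_rep {G V : Type*} [Monoid G] [AddCommGroup V] [Module ℝ V]
    [FiniteDimensional ℝ V] (ρ : G →* End ℝ V) :
    ∃ τ : G →* Matrix (Fin (finrank ℝ V)) (Fin (finrank ℝ V)) ℝ, ∀ g, τ g = 1 ↔ ρ g = 1 := by
  let e := LinearMap.toMatrixAlgEquiv (finBasis ℝ V)
  exact ⟨(e : End ℝ V →* _).comp ρ, fun g => map_eq_one_iff e e.injective⟩

theorem two_le_of_matrix_rep_swap_mul_swap_ne_one {α : Type*} [DecidableEq α] {d : ℕ}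
    (τ : Perm α →* Matrix (Fin d) (Fin d) ℝ) {a b c : α} (hab : a ≠ b) (hac : a ≠ c)
    (h : τ (swap a b * swap a c) ≠ 1) : 2 ≤ d := by
  by_contra! hd
  have hcomm : ∀ A B : Matrix (Fin d) (Fin d) ℝ, A * B = B * A := by
    intro A B
    interval_cases d
    · exact Subsingleton.elim _ _
    · ext i j
      fin_cases i; fin_cases j
      simp [Matrix.mul_apply, mul_comm]
  obtain ⟨g, hg⟩ := isConj_iff.1 (Perm.isConj_swap hab hac)
  apply h
  rw [← hg, map_mul, map_mul, map_mul, hcomm (τ g), mul_assoc, ← map_mul τ g, mul_inv_cancel,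
    map_one, mul_one, ← map_mul, swap_mul_self, map_one]

/-- An involution of determinant one in dimension at most two is central. -/
theorem commute_of_sq_eq_one_of_det_eq_one {d : ℕ} (hd : d ≤ 2) {A : Matrix (Fin d) (Fin d) ℝ}
    (hA : A * A = 1) (hdet : A.det = 1) (B : Matrix (Fin d) (Fin d) ℝ) : B * A = A * B := by
  interval_cases d
  · exact Subsingleton.elim _ _
  · ext i j
    fin_cases i; fin_cases j
    simp [Matrix.mul_apply, mul_comm]
  · have h01 := congrFun (congrFun hA 0) 1
    have h10 := congrFun (congrFun hA 1) 0
    have h00 := congrFun (congrFun hA 0) 0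
    have h11 := congrFun (congrFun hA 1) 1
    simp [Matrix.mul_apply, Fin.sum_univ_two] at h01 h10 h00 h11
    rw [Matrix.det_fin_two] at hdet
    have htr : A 0 0 + A 1 1 ≠ 0 := by
      intro h
      have : A 1 1 = -A 0 0 := by linarith
      rw [this] at hdet
      linarith
    have hq : A 0 1 = 0 := by
      have : A 0 1 * (A 0 0 + A 1 1) = 0 := by linarith
      exact (mul_eq_zero.1 this).resolve_right htr
    have hr : A 1 0 = 0 := by
      have : A 1 0 * (A 0 0 + A 1 1) = 0 := by linarith
      exact (mul_eq_zero.1 this).resolve_right htr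
    have hps : A 0 0 = A 1 1 := by
      have : (A 0 0 - A 1 1) * (A 0 0 + A 1 1) = 0 := by linarith
      exact sub_eq_zero.1 ((mul_eq_zero.1 this).resolve_right htr)
    ext i j
    fin_cases i <;> fin_cases j <;>
      simp [Matrix.mul_apply, Fin.sum_univ_two, hq, hr, hps] <;> ring

theorem three_le_of_matrix_rep_swap_mul_swap_ne_one {α : Type*} [DecidableEq α] {d : ℕ}
    (τ : Perm α →* Matrix (Fin d) (Fin d) ℝ) {a b c e : α} (hab : a ≠ b) (hac : a ≠ c)
    (hae : a ≠ e) (hbc : b ≠ c) (hbe : b ≠ e) (hce : c ≠ e)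
    (h : τ (swap a b * swap c e) ≠ 1) : 3 ≤ d := by
  by_contra! hd
  set x := swap a b * swap c e with hx
  set y := swap a c * swap b e with hy
  have hxx : x * x = 1 := by
    ext i
    simp only [hx, Perm.mul_apply, Perm.one_apply, swap_apply_def]
    grind
  have hconjy : swap b c * x * (swap b c)⁻¹ = y := by
    ext i
    simp only [hx, hy, swap_inv, Perm.mul_apply, swap_apply_def]
    grind
  have hconjxy : swap b e * x * (swap b e)⁻¹ = x * y := by
    ext i
    simp only [hx, hy, swap_inv, Perm.mul_apply, swap_apply_def]
    grind
  have hdetconj : ∀ g w : Perm α, (τ (g * w * g⁻¹)).det = (τ w).det := by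
    intro g w
    have h1 : (τ g).det * (τ g⁻¹).det = 1 := by
      rw [← Matrix.det_mul, ← map_mul, mul_inv_cancel, map_one, Matrix.det_one]
    rw [map_mul, map_mul, Matrix.det_mul, Matrix.det_mul, mul_right_comm, h1, one_mul]
  have hA : τ x * τ x = 1 := by rw [← map_mul, hxx, map_one]
  have hdet : (τ x).det = 1 := by
    have h1 := hdetconj (swap b e) x
    have h2 := hdetconj (swap b c) x
    rw [hconjxy, map_mul, Matrix.det_mul, ← hconjy, h2] at h1
    rw [← h1, ← Matrix.det_mul, hA, Matrix.det_one]
  have hconj : ∀ g, τ (g * x * g⁻¹) = τ x := by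
    intro g
    rw [map_mul, map_mul, commute_of_sq_eq_one_of_det_eq_one (by omega) hA hdet, mul_assoc,
      ← map_mul, mul_inv_cancel, map_one, mul_one]
  apply h
  have h1 := hconj (swap b e)
  rw [hconjxy, map_mul, ← hconjy, hconj, hA] at h1
  exact h1.symm

/-- Some nontrivial even permutation acts trivially in every real representation of dimension less
than `card α - 1`. -/
theorem exists_perm_card_sub_one_le_finrank (m : ℕ) : ∀ (α : Type) [Fintype α] [DecidableEq α],
    Fintype.card α = m + 3 → ∃ z : Perm α, z ≠ 1 ∧ Perm.sign z = 1 ∧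
      ∀ (V : Type) [AddCommGroup V] [Module ℝ V] [FiniteDimensional ℝ V]
        (ρ : Perm α →* End ℝ V), ρ z ≠ 1 → m + 2 ≤ finrank ℝ V := by
  induction m using Nat.twoStepInduction with
  | zero =>
    intro α _ _ hα
    let f := (Fintype.equivFinOfCardEq hα).symm
    have h01 : f 0 ≠ f 1 := f.injective.ne (by decide)
    have h02 : f 0 ≠ f 2 := f.injective.ne (by decide)
    have h12 : f 1 ≠ f 2 := f.injective.ne (by decide)
    refine ⟨swap (f 0) (f 1) * swap (f 0) (f 2),
      (Perm.isThreeCycle_swap_mul_swap_same h01 h02 h12).ne_one, ?_, ?_⟩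
    · rw [Perm.sign_mul, Perm.sign_swap h01, Perm.sign_swap h02]; rfl
    · intro V _ _ _ ρ hρ
      obtain ⟨τ, hτ⟩ := exists_matrix_rep ρ
      exact two_le_of_matrix_rep_swap_mul_swap_ne_one τ h01 h02 (mt (hτ _).1 hρ)
  | one =>
    intro α _ _ hα
    let f := (Fintype.equivFinOfCardEq hα).symm
    have hf : ∀ i j, i ≠ j → f i ≠ f j := fun i j h => f.injective.ne h
    have h01 := hf 0 1 (by decide)
    have h02 := hf 0 2 (by decide)
    have h03 := hf 0 3 (by decide)
    have h23 := hf 2 3 (by decide)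
    refine ⟨swap (f 0) (f 1) * swap (f 2) (f 3), ?_, ?_, ?_⟩
    · intro h
      have h1 := Equiv.congr_fun h (f 0)
      rw [Perm.mul_apply, swap_apply_of_ne_of_ne h02 h03, swap_apply_left] at h1
      exact h01 h1.symm
    · rw [Perm.sign_mul, Perm.sign_swap h01, Perm.sign_swap h23]; rfl
    · intro V _ _ _ ρ hρ
      obtain ⟨τ, hτ⟩ := exists_matrix_rep ρ
      exact three_le_of_matrix_rep_swap_mul_swap_ne_one τ h01 h02 h03 (hf 1 2 (by decide))
        (hf 1 3 (by decide)) h23 (mt (hτ _).1 hρ)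
  | more m ih _ =>
    intro α _ _ hα
    obtain ⟨a, b, hab⟩ := Fintype.exists_pair_of_one_lt_card (α := α) (by omega)
    have hβ : Fintype.card {x // x ≠ a ∧ x ≠ b} = m + 3 := by
      have h1 : (Finset.univ.filter fun x => x ≠ a ∧ x ≠ b) = ({a, b} : Finset α)ᶜ := by
        ext x; simp
      rw [Fintype.card_subtype, h1, Finset.card_compl, Finset.card_pair hab, hα]
      omega
    obtain ⟨z, hz1, hz, hdim⟩ := ih {x // x ≠ a ∧ x ≠ b} hβ
    refine ⟨Perm.ofSubtype z, ?_, (Perm.sign_ofSubtype z).trans hz, ?_⟩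
    · rwa [Ne, map_eq_one_iff _ Perm.ofSubtype_injective]
    intro V _ _ _ ρ hρ
    have hstep := @card_sub_one_le_finrank_of_ne_on_fixed α V _ _ _ _ _ (by omega) a b hab z hz
      (fun W _ _ _ σ hσ => by
        have := hdim W σ hσ
        omega)
    rw [hα] at hstep
    by_contra hlt
    apply hρ
    have hplus : ∀ v, ρ (swap a b) v = v → ρ (Perm.ofSubtype z) v = v := by
      intro v hv
      by_contra hzv
      exact hlt (hstep ρ hv hzv)
    have hminus : ∀ v, ρ (swap a b) v = -v → ρ (Perm.ofSubtype z) v = v := by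
      intro v hv
      by_contra hzv
      refine hlt (hstep (signTwist ρ) (v := v) ?_ ?_)
      · simp [signTwist, Perm.sign_swap hab, hv]
      · simpa [signTwist, Perm.sign_ofSubtype, hz] using hzv
    ext v
    have h1 := hplus (v + ρ (swap a b) v) (by rw [map_add, rho_swap_swap, add_comm])
    have h2 := hminus (v - ρ (swap a b) v) (by rw [map_sub, rho_swap_swap]; abel)
    have h3 : (2 : ℝ) • ρ (Perm.ofSubtype z) v = (2 : ℝ) • v := by
      rw [← map_smul, show (2 : ℝ) • v =
        (v + ρ (swap a b) v) + (v - ρ (swap a b) v) by module, map_add, h1, h2]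
    rw [End.one_apply]
    exact smul_right_injective V (two_ne_zero (α := ℝ)) h3

/-- The permutation representation on the vectors orthogonal to `(1, …, 1)`. -/
noncomputable def standardRep (k : ℕ) : Perm (Fin k) →*
    End ℝ (ℝ ∙ (WithLp.toLp 2 1 : EuclideanSpace ℝ (Fin k)))ᗮ where
  toFun σ := (LinearIsometryEquiv.piLpCongrLeft 2 ℝ ℝ σ).toLinearEquiv.toLinearMap.restrict (by
    intro x hx
    rw [Submodule.mem_orthogonal_singleton_iff_inner_right] at hx ⊢
    rw [← hx]
    simp only [PiLp.inner_apply]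
    exact Fintype.sum_equiv σ.symm _ _ fun i => by simp)
  map_one' := rfl
  map_mul' _ _ := rfl

theorem standardRep_apply {k : ℕ} (σ : Perm (Fin k))
    (x : (ℝ ∙ (WithLp.toLp 2 1 : EuclideanSpace ℝ (Fin k)))ᗮ) (i : Fin k) :
    (standardRep k σ x : EuclideanSpace ℝ (Fin k)) i = (x : EuclideanSpace ℝ (Fin k)) (σ⁻¹ i) :=
  rfl

theorem standardRep_injective (k : ℕ) : Function.Injective (standardRep k) := by
  rw [injective_iff_map_eq_one]
  intro σ hσ
  ext i : 1
  by_contra hi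
  rw [Perm.one_apply] at hi
  let x : EuclideanSpace ℝ (Fin k) := EuclideanSpace.single i 1 - EuclideanSpace.single (σ i) 1
  have hx : x ∈ (ℝ ∙ (WithLp.toLp 2 1 : EuclideanSpace ℝ (Fin k)))ᗮ := by
    rw [Submodule.mem_orthogonal_singleton_iff_inner_right]
    simp [x, inner_sub_right, EuclideanSpace.inner_single_right]
  have h := standardRep_apply σ ⟨x, hx⟩ (σ i)
  rw [hσ] at h
  simp [x, hi, Ne.symm hi] at h
  linarith

theorem star_standardRep_mul_self {k : ℕ} (σ : Perm (Fin k)) :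
    star (standardRep k σ) * standardRep k σ = 1 := by
  refine LinearMap.ext fun x => ext_inner_right ℝ fun y => ?_
  rw [End.mul_apply, LinearMap.star_eq_adjoint, LinearMap.adjoint_inner_left]
  exact LinearIsometryEquiv.inner_map_map (LinearIsometryEquiv.piLpCongrLeft 2 ℝ ℝ σ) x y

theorem exists_injective_orthogonalGroup (n : ℕ) :
    ∃ ρ : Perm (Fin n) →* Matrix.orthogonalGroup (Fin (n - 1)) ℝ, Function.Injective ρ := by
  cases n with
  | zero => exact ⟨1, fun _ _ _ => Subsingleton.elim _ _⟩
  | succ k =>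
    have : Fact (finrank ℝ (EuclideanSpace ℝ (Fin (k + 1))) = k + 1) := ⟨by simp⟩
    have hne : (WithLp.toLp 2 1 : EuclideanSpace ℝ (Fin (k + 1))) ≠ 0 := by
      intro h
      have h0 := congrArg (fun x : EuclideanSpace ℝ (Fin (k + 1)) => x 0) h
      simp at h0
    let b := (stdOrthonormalBasis ℝ
      (ℝ ∙ (WithLp.toLp 2 1 : EuclideanSpace ℝ (Fin (k + 1))))ᗮ).reindex
        (finCongr (Submodule.finrank_orthogonal_span_singleton (n := k) hne))
    let e := LinearMap.toMatrixOrthonormal b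
    refine ⟨((e : End ℝ _ →* _).comp (standardRep (k + 1))).codRestrict
      (Matrix.orthogonalGroup (Fin k) ℝ) fun σ => ?_, fun σ τ h => ?_⟩
    · rw [Matrix.mem_orthogonalGroup_iff']
      change star (e (standardRep (k + 1) σ)) * e (standardRep (k + 1) σ) = 1
      rw [← map_star, ← map_mul, star_standardRep_mul_self, map_one]
    · exact standardRep_injective _ (e.injective (congrArg Subtype.val h))

/-- The symmetric group `S_n` admits a faithful orthogonal representation on `ℝ^{n-1}`,
and for `n ≥ 3` every faithful real linear representation of `S_n` has dimension at
least `n - 1`. -/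
theorem symmetricGroup_faithful_rep (n : ℕ) :
    (∃ ρ : Equiv.Perm (Fin n) →* Matrix.orthogonalGroup (Fin (n - 1)) ℝ,
        Function.Injective ρ) ∧
      (3 ≤ n → ∀ d : ℕ, ∀ ρ : Equiv.Perm (Fin n) →* GL (Fin d) ℝ,
        Function.Injective ρ → n - 1 ≤ d) := by
  refine ⟨exists_injective_orthogonalGroup n, fun hn d ρ hρ => ?_⟩
  obtain ⟨m, rfl⟩ := Nat.exists_eq_add_of_le' hn
  obtain ⟨z, hz, -, hdim⟩ := exists_perm_card_sub_one_le_finrank m (Fin (m + 3)) (by simp)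
  let e : Matrix (Fin d) (Fin d) ℝ ≃ₐ[ℝ] End ℝ (Fin d → ℝ) := Matrix.toLinAlgEquiv'
  have h := hdim (Fin d → ℝ) ((e : Matrix (Fin d) (Fin d) ℝ →* _).comp
    ((Units.coeHom _).comp ρ)) fun h => hz (hρ ?_)
  · simpa using h
  · rw [map_one]
    exact Units.ext ((map_eq_one_iff e e.injective).1 h)
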